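/- Let 0<λ<1 and δ > 0 be such that γ := λ − log(λ) − 1 − δ > 0, set K = (λ/2) · ( (1−λ)e^{−δ}/(λ√(2π)(1−e^{−δ})²) + 1/(1−λ)² ), let Z ~ Borel(λ) with size-biased version Z⋆, and let m(θ) = E[e^{θZ}]. Then for every θ ∈ (0, γ), E[e^{θZ⋆}] − E[e^{θZ}] ≤ K θ m(θ). -/

import Mathlib

open scoped BigOperators

/-- The Borel(λ) mass function: `q j = e^{-λ j}(λ j)^{j-1}/j!` for `j ≥ 1`, and `0` at `j = 0`. -/
noncomputable def borelPMF (lam : ℝ) (j : ℕ) : ℝ :=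
  if j = 0 then 0 else Real.exp (-(lam * j)) * (lam * j) ^ (j - 1) / (Nat.factorial j)

open Real Set Filter Topology MeasureTheory ProbabilityTheory
open scoped Nat

/-- The coefficient `j ^ (j - 1) / j!` of the tree function, equal to `0` at `j = 0`. -/
noncomputable def treeCoeff (j : ℕ) : ℝ := (j : ℝ) ^ j / j ! / j

/-- The sum `∑ j ^ k a_j e ^ (s j)`, the `k`-th derivative in `s` of the tree function at `e ^ s`. -/
noncomputable def treeMoment (k : ℕ) (s : ℝ) : ℝ :=
  ∑' j : ℕ, treeCoeff j * ((j : ℝ) ^ k * exp (s * j))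

lemma treeCoeff_nonneg (j : ℕ) : 0 ≤ treeCoeff j := by unfold treeCoeff; positivity

lemma treeCoeff_le_exp (j : ℕ) : treeCoeff j ≤ exp j := by
  rcases Nat.eq_zero_or_pos j with rfl | hj
  · simp [treeCoeff]
  · have hj' : (1 : ℝ) ≤ j := by exact_mod_cast hj
    exact (div_le_self (by positivity) hj').trans
      (Real.pow_div_factorial_le_exp _ (Nat.cast_nonneg j) j)

lemma summable_treeCoeff_mul_exp {s : ℝ} (hs : s < -1) :
    Summable fun j : ℕ ↦ treeCoeff j * exp (s * j) := by
  have h : Summable fun j : ℕ ↦ exp (s + 1) ^ j :=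
    summable_geometric_of_lt_one (exp_pos _).le (by rw [exp_lt_one_iff]; linarith)
  refine h.of_nonneg_of_le (fun j ↦ mul_nonneg (treeCoeff_nonneg j) (exp_pos _).le) fun j ↦ ?_
  calc treeCoeff j * exp (s * j) ≤ exp j * exp (s * j) :=
        mul_le_mul_of_nonneg_right (treeCoeff_le_exp j) (exp_pos _).le
    _ = exp (s + 1) ^ j := by rw [← exp_add, ← exp_nat_mul]; ring_nf

/-- The atomic measure on `ℕ` with weights `treeCoeff`. -/
noncomputable def treeMeasure : Measure ℕ :=
  Measure.sum fun j : ℕ ↦ ENNReal.ofReal (treeCoeff j) • Measure.dirac j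

lemma integral_treeMeasure (f : ℕ → ℝ) :
    ∫ j, f j ∂treeMeasure = ∑' j, treeCoeff j * f j := by
  rw [treeMeasure, integral_sum_dirac (by simp)]
  simp [ENNReal.toReal_ofReal (treeCoeff_nonneg _)]

lemma mem_interior_integrableExpSet_treeMeasure {s : ℝ} (hs : s < -1) :
    s ∈ interior (integrableExpSet (fun j : ℕ ↦ (j : ℝ)) treeMeasure) := by
  refine interior_maximal (fun t (ht : t < -1) ↦ ?_) isOpen_Iio hs
  rw [integrableExpSet, mem_ofPred_eq, treeMeasure, integrable_sum_dirac_iff (by simp)]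
  simpa [ENNReal.toReal_ofReal (treeCoeff_nonneg _)] using summable_treeCoeff_mul_exp ht

lemma hasDerivAt_treeMoment (k : ℕ) {s : ℝ} (hs : s < -1) :
    HasDerivAt (treeMoment k) (treeMoment (k + 1) s) s := by
  have h := hasDerivAt_integral_pow_mul_exp_real
    (mem_interior_integrableExpSet_treeMeasure hs) k
  simp only [integral_treeMeasure] at h
  exact h

lemma analyticAt_treeMoment_zero {s : ℝ} (hs : s < -1) : AnalyticAt ℝ (treeMoment 0) s := by
  have h := analyticAt_mgf (mem_interior_integrableExpSet_treeMeasure hs)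
  have e : mgf (fun j : ℕ ↦ (j : ℝ)) treeMeasure = treeMoment 0 := by
    funext t
    simp [mgf, treeMoment, integral_treeMeasure]
  rwa [e] at h

lemma sum_antidiagonal_treeCoeff (n : ℕ) :
    ∑ p ∈ Finset.HasAntidiagonal.antidiagonal n, treeCoeff p.1 * ((-(p.1 : ℝ)) ^ p.2 / p.2 !) =
      if n = 1 then 1 else 0 := by
  rcases n with _ | _ | n
  · simp [treeCoeff]
  · simp [treeCoeff, Finset.Nat.antidiagonal_succ]
  have h := congrFun (fwdDiff_iter_pow_eq_zero_of_lt (R := ℝ) (Nat.lt_succ_self (n + 1))) 0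
  rw [fwdDiff_iter_eq_sum_shift] at h
  rw [Finset.Nat.sum_antidiagonal_eq_sum_range_succ_mk, if_neg (by omega)]
  have hne : ((n + 2)! : ℝ) ≠ 0 := by positivity
  refine (mul_eq_zero.1 ?_).resolve_left hne
  rw [Finset.mul_sum]
  refine Eq.trans (Finset.sum_congr rfl fun j hj ↦ ?_) h
  have hj' : j ≤ n + 2 := by simpa [Nat.lt_succ_iff] using hj
  rcases Nat.eq_zero_or_pos j with rfl | hj0
  · simp [treeCoeff]
  have hc : ((n + 2)! : ℝ) = (n + 2).choose j * j ! * (n + 2 - j)! := by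
    exact_mod_cast (Nat.choose_mul_factorial_mul_factorial hj').symm
  have hp : (j : ℝ) ^ (n + 1) * j = (j : ℝ) ^ j * (j : ℝ) ^ (n + 2 - j) := by
    rw [← pow_add, ← pow_succ]; congr 1; omega
  have hj1 : (j : ℝ) ≠ 0 := by positivity
  have e1 : (j : ℝ) ^ (n + 1) = (j : ℝ) ^ j * (j : ℝ) ^ (n + 2 - j) / j := by
    rw [← hp]; field_simp
  have e2 : (-(j : ℝ)) ^ (n + 2 - j) = (-1) ^ (n + 2 - j) * (j : ℝ) ^ (n + 2 - j) := by
    rw [← mul_pow]; simp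
  simp only [treeCoeff, zsmul_eq_mul, nsmul_eq_mul, mul_one, zero_add]
  push_cast
  rw [e1, hc, e2]
  field_simp

lemma treeMoment_zero_of_small {w : ℝ} (hw : 0 < w) (hs : log w + w < -1) :
    treeMoment 0 (log w - w) = w := by
  set F : ℕ × ℕ → ℝ := fun p ↦ treeCoeff p.1 * w ^ p.1 * ((-(p.1 * w)) ^ p.2 / p.2 !) with hF
  have hexp (x : ℝ) : HasSum (fun k : ℕ ↦ x ^ k / k !) (exp x) := by
    simpa [exp_eq_exp_ℝ] using NormedSpace.expSeries_div_hasSum_exp x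
  have hpow (c : ℝ) (j : ℕ) : w ^ j * exp (j * c) = exp ((log w + c) * j) := by
    rw [add_mul, exp_add, mul_comm (log w), exp_nat_mul (log w), exp_log hw, mul_comm c]
  have hnorm (j : ℕ) : HasSum (fun k ↦ ‖F (j, k)‖) (treeCoeff j * exp ((log w + w) * j)) := by
    rw [← hpow w j, ← mul_assoc]
    convert! (hexp (j * w)).mul_left (treeCoeff j * w ^ j) using 2 with k
    simp [hF, abs_of_nonneg (treeCoeff_nonneg j), abs_of_pos hw]
  have hsum : Summable F := by
    refine Summable.of_norm ((summable_prod_of_nonneg fun _ ↦ norm_nonneg _).2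
      ⟨fun j ↦ (hnorm j).summable, ?_⟩)
    simp only [(hnorm _).tsum_eq]
    exact summable_treeCoeff_mul_exp hs
  have h1 : ∑' p, F p = treeMoment 0 (log w - w) := by
    rw [hsum.tsum_prod]
    refine tsum_congr fun j ↦ ?_
    have := ((hexp (-(j * w))).mul_left (treeCoeff j * w ^ j)).tsum_eq
    rw [hF, this, mul_assoc, pow_zero, one_mul, sub_eq_add_neg, ← hpow, mul_neg]
  rw [← h1, ← Finset.HasAntidiagonal.sigmaAntidiagonalEquivProd.tsum_eq F,
    Summable.tsum_sigma' (f := fun c ↦ F (Finset.HasAntidiagonal.sigmaAntidiagonalEquivProd c))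
      (fun n ↦ (hasSum_fintype _).summable)
      (Finset.HasAntidiagonal.sigmaAntidiagonalEquivProd.summable_iff.2 hsum)]
  have h2 (n : ℕ) : ∑' c : Finset.HasAntidiagonal.antidiagonal n,
      F (Finset.HasAntidiagonal.sigmaAntidiagonalEquivProd ⟨n, c⟩) = if n = 1 then w else 0 := by
    rw [tsum_fintype]
    trans ∑ p ∈ Finset.HasAntidiagonal.antidiagonal n, F p
    · exact Finset.sum_coe_sort (Finset.HasAntidiagonal.antidiagonal n) F
    trans w ^ n * ∑ p ∈ Finset.HasAntidiagonal.antidiagonal n,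
        treeCoeff p.1 * ((-(p.1 : ℝ)) ^ p.2 / p.2 !)
    · rw [Finset.mul_sum]
      refine Finset.sum_congr rfl fun p hp ↦ ?_
      rw [← Finset.HasAntidiagonal.mem_antidiagonal.1 hp, hF, pow_add]
      simp only [← neg_mul, mul_pow]
      ring
    · rw [sum_antidiagonal_treeCoeff]
      split_ifs with h <;> simp [h]
  rw [tsum_congr h2, tsum_ite_eq]

lemma log_sub_self_lt_neg_one {w : ℝ} (hw : w ∈ Ioo (0 : ℝ) 1) : log w - w < -1 := by
  linarith [log_lt_sub_one_of_pos hw.1 hw.2.ne]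

lemma treeMoment_zero_log_sub {w : ℝ} (hw : w ∈ Ioo (0 : ℝ) 1) :
    treeMoment 0 (log w - w) = w := by
  have hA : AnalyticOnNhd ℝ (fun w ↦ treeMoment 0 (log w - w)) (Ioo 0 1) := fun x hx ↦
    (analyticAt_treeMoment_zero (log_sub_self_lt_neg_one hx)).comp_of_eq
      ((analyticAt_id.log hx.1).sub analyticAt_id) rfl
  refine hA.eqOn_of_preconnected_of_eventuallyEq analyticOnNhd_id isPreconnected_Ioo
    (z₀ := 1 / 8) (by norm_num) ?_ hw
  filter_upwards [Ioo_mem_nhds (show (0 : ℝ) < 1 / 8 by norm_num)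
    (show (1 / 8 : ℝ) < 1 / 4 by norm_num)] with x hx
  refine treeMoment_zero_of_small hx.1 ?_
  have h1 : log x ≤ log (1 / 4) := log_le_log hx.1 hx.2.le
  have h2 : log (1 / 4) = -(2 * log 2) := by
    rw [one_div, log_inv, show (4 : ℝ) = 2 ^ 2 by norm_num, log_pow]; norm_num
  linarith [log_two_gt_d9, hx.2]

lemma treeMoment_succ_log_sub {k : ℕ} {g : ℝ → ℝ} {g' w : ℝ} (hw : w ∈ Ioo (0 : ℝ) 1)
    (hg : ∀ x ∈ Ioo (0 : ℝ) 1, treeMoment k (log x - x) = g x) (hd : HasDerivAt g g' w) :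
    treeMoment (k + 1) (log w - w) = g' * (w / (1 - w)) := by
  have h := HasDerivAt.comp (h := fun x ↦ log x - x) w
    (hasDerivAt_treeMoment k (log_sub_self_lt_neg_one hw))
    ((hasDerivAt_log hw.1.ne').sub (hasDerivAt_id w))
  have he : (fun x ↦ treeMoment k (log x - x)) =ᶠ[𝓝 w] g := by
    filter_upwards [Ioo_mem_nhds hw.1 hw.2] with x hx using hg x hx
  have h' := h.unique (hd.congr_of_eventuallyEq he)
  have h0 : w ≠ 0 := hw.1.ne'
  have h1 : 1 - w ≠ 0 := (sub_pos.2 hw.2).ne'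
  rw [← h']
  field_simp

lemma treeMoment_one_log_sub {w : ℝ} (hw : w ∈ Ioo (0 : ℝ) 1) :
    treeMoment 1 (log w - w) = w / (1 - w) := by
  rw [treeMoment_succ_log_sub hw (fun x hx ↦ treeMoment_zero_log_sub hx) (hasDerivAt_id w),
    one_mul]

lemma treeMoment_two_log_sub {w : ℝ} (hw : w ∈ Ioo (0 : ℝ) 1) :
    treeMoment 2 (log w - w) = w / (1 - w) ^ 3 := by
  have h1 : 1 - w ≠ 0 := (sub_pos.2 hw.2).ne'
  rw [treeMoment_succ_log_sub hw (fun x hx ↦ treeMoment_one_log_sub hx)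
    ((hasDerivAt_id w).div ((hasDerivAt_id w).const_sub 1) h1)]
  simp only [id]
  field_simp
  ring

lemma treeMoment_two_le {δ s : ℝ} (hδ : 0 < δ) (hs : s ≤ -1 - δ) :
    treeMoment 2 s ≤ exp (-δ) / (√(2 * π) * (1 - exp (-δ)) ^ 2) := by
  have hr : ‖exp (-δ)‖ < 1 := by
    rw [norm_of_nonneg (exp_pos _).le, exp_lt_one_iff]; linarith
  have hgeo := (hasSum_coe_mul_geometric_of_norm_lt_one hr).mul_left (√(2 * π))⁻¹
  have hle (j : ℕ) : treeCoeff j * ((j : ℝ) ^ 2 * exp (s * j)) ≤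
      (√(2 * π))⁻¹ * (j * exp (-δ) ^ j) := by
    rcases Nat.eq_zero_or_pos j with rfl | hj
    · simp [treeCoeff]
    have hj1 : (1 : ℝ) ≤ j := by exact_mod_cast hj
    have hstir : √(2 * π) * (j / exp 1) ^ j ≤ j ! :=
      le_trans (mul_le_mul_of_nonneg_right
        (sqrt_le_sqrt (le_mul_of_one_le_right (by positivity) hj1)) (by positivity))
        (Stirling.le_factorial_stirling j)
    have hexp : exp (s * j) ≤ exp (-δ) ^ j / exp 1 ^ j := by
      rw [← div_pow, ← exp_sub, ← exp_nat_mul, exp_le_exp, mul_comm s]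
      exact mul_le_mul_of_nonneg_left (by linarith) (by positivity)
    have hcoef : (j : ℝ) ^ j / j ! ≤ exp 1 ^ j * (√(2 * π))⁻¹ := by
      rw [div_pow] at hstir
      rw [div_le_iff₀ (by positivity)]
      calc (j : ℝ) ^ j = exp 1 ^ j * (√(2 * π))⁻¹ * (√(2 * π) * (j ^ j / exp 1 ^ j)) := by
            field_simp
        _ ≤ _ := mul_le_mul_of_nonneg_left hstir (by positivity)
    calc treeCoeff j * ((j : ℝ) ^ 2 * exp (s * j)) = j * ((j : ℝ) ^ j / j ! * exp (s * j)) := by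
          unfold treeCoeff; field_simp
      _ ≤ j * (exp 1 ^ j * (√(2 * π))⁻¹ * (exp (-δ) ^ j / exp 1 ^ j)) := by gcongr
      _ = _ := by field_simp
  have hnn (j : ℕ) : 0 ≤ treeCoeff j * ((j : ℝ) ^ 2 * exp (s * j)) :=
    mul_nonneg (treeCoeff_nonneg j) (by positivity)
  refine ((hgeo.summable.of_nonneg_of_le hnn hle).tsum_le_tsum hle hgeo.summable).trans
    (le_of_eq ?_)
  rw [hgeo.tsum_eq]
  field_simp

/-- The trapezoid rule overestimates the increment of a function with convex derivative, applied to
`(w - a) / (1 - w)` as a function of `θ = log w - w - (log a - a)`. -/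
lemma trapezoid_bound {a w : ℝ} (ha : 0 < a) (haw : a ≤ w) (hw : w < 1) :
    (w - a) / (1 - w) ≤
      (log w - w - (log a - a)) / 2 * ((1 - a) * (w / (1 - w) ^ 3) + a / (1 - a) ^ 2) := by
  set θ : ℝ → ℝ := fun x ↦ log x - x - (log a - a) with hθ
  have hθd {x : ℝ} (hx : 0 < x) : HasDerivAt θ (1 / x - 1) x := by
    rw [one_div]
    exact ((hasDerivAt_log hx.ne').sub (hasDerivAt_id x)).sub_const (log a - a)
  have hq {x : ℝ} (hx : x < 1) (n : ℕ) : HasDerivAt (fun x : ℝ ↦ ((1 - x) ^ n)⁻¹)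
      (n / (1 - x) ^ (n + 1)) x := by
    have h1 : 1 - x ≠ 0 := (sub_pos.2 hx).ne'
    refine ((((hasDerivAt_id x).const_sub 1).pow n).inv (pow_ne_zero n h1)).congr_deriv ?_
    rcases n with _ | n
    · simp
    · simp only [id, Nat.add_sub_cancel, Pi.pow_apply]; field_simp; ring
  have mono (f f' : ℝ → ℝ) (hf : ∀ x ∈ Icc a w, HasDerivAt f (f' x) x)
      (hf' : ∀ x ∈ Icc a w, 0 ≤ f' x) : MonotoneOn f (Icc a w) := by
    refine monotoneOn_of_deriv_nonneg (convex_Icc a w)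
      (fun x hx ↦ (hf x hx).continuousAt.continuousWithinAt)
      (fun x hx ↦ (hf x (interior_subset hx)).differentiableAt.differentiableWithinAt)
      fun x hx ↦ ?_
    rw [(hf x (interior_subset hx)).deriv]
    exact hf' x (interior_subset hx)
  have haI : a ∈ Icc a w := ⟨le_rfl, haw⟩
  have hpos {x : ℝ} (hx : x ∈ Icc a w) : 0 < x ∧ 0 < 1 - x :=
    ⟨ha.trans_le hx.1, by linarith [hx.2]⟩
  have hθa : θ a = 0 := by simp [hθ]
  have hθ0 : ∀ x ∈ Icc a w, 0 ≤ θ x := fun x hx ↦ by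
    have := mono θ (fun x ↦ 1 / x - 1) (fun x hx ↦ hθd (hpos hx).1) (fun x hx ↦ by
      rw [sub_nonneg, le_div_iff₀ (hpos hx).1]; linarith [(hpos hx).2]) haI hx hx.1
    rwa [hθa] at this
  have ha1 : 0 < 1 - a := (hpos haI).2
  set P : ℝ → ℝ := fun x ↦ (a / (1 - a) ^ 2 - (1 - a) * (x * ((1 - x) ^ 3)⁻¹) +
    θ x * ((1 - a) * ((x + 2 * x ^ 2) * ((1 - x) ^ 5)⁻¹))) with hP
  have hP0 : ∀ x ∈ Icc a w, 0 ≤ P x := fun x hx ↦ by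
    have := mono P (fun x ↦ θ x * ((1 - a) * ((1 + 8 * x + 6 * x ^ 2) / (1 - x) ^ 6)))
      (fun x hx ↦ ?_) (fun x hx ↦ ?_) haI hx hx.1
    · refine le_trans (le_of_eq ?_) this
      simp only [hP, hθa]
      field_simp
      ring
    · obtain ⟨h0, h1⟩ := hpos hx
      have hx1 : x < 1 := by linarith
      refine (((((hasDerivAt_id x).mul (hq hx1 3)).const_mul (1 - a)).const_sub _).add
        ((hθd h0).mul ((((hasDerivAt_id x).add (((hasDerivAt_id x).pow 2).const_mul 2)).mul
          (hq hx1 5)).const_mul (1 - a)))).congr_deriv ?_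
      simp
      field_simp
      ring
    · obtain ⟨h0, h1⟩ := hpos hx
      have := hθ0 x hx
      positivity
  have hfin := mono (fun x ↦ θ x / 2 * ((1 - a) * (x * ((1 - x) ^ 3)⁻¹) + a / (1 - a) ^ 2) -
      (x - a) * ((1 - x) ^ 1)⁻¹) (fun x ↦ (1 / x - 1) / 2 * P x)
    (fun x hx ↦ ?_) (fun x hx ↦ ?_) haI ⟨haw, le_rfl⟩ haw
  · simp only [hθa, sub_self, zero_div, zero_mul, pow_one, sub_nonneg] at hfin
    simpa only [div_eq_mul_inv] using hfin
  · obtain ⟨h0, h1⟩ := hpos hx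
    have hx1 : x < 1 := by linarith
    refine ((((hθd h0).div_const 2).mul ((((hasDerivAt_id x).mul (hq hx1 3)).const_mul
      (1 - a)).add_const _)).sub (((hasDerivAt_id x).sub_const a).mul (hq hx1 1))).congr_deriv ?_
    simp [hP]
    field_simp
    ring
  · obtain ⟨h0, h1⟩ := hpos hx
    have h2 : 0 ≤ 1 / x - 1 := by rw [sub_nonneg, le_div_iff₀ h0]; linarith
    exact mul_nonneg (by positivity) (hP0 x hx)

lemma exists_log_sub_eq {a s : ℝ} (ha : 0 < a) (ha1 : a < 1) (hs : log a - a < s) (hs1 : s < -1) :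
    ∃ w, a < w ∧ w < 1 ∧ log w - w = s := by
  have hc : ContinuousOn (fun x ↦ log x - x) (Icc a 1) :=
    (continuousOn_log.mono fun x hx ↦ (ha.trans_le hx.1).ne').sub continuousOn_id
  obtain ⟨w, hw, h⟩ := intermediate_value_Ioo ha1.le hc (show s ∈ Ioo _ _ from ⟨hs, by simpa⟩)
  exact ⟨w, hw.1, hw.2, h⟩

lemma borelPMF_eq_treeCoeff {lam : ℝ} (hlam : 0 < lam) (j : ℕ) :
    borelPMF lam j = lam⁻¹ * (treeCoeff j * exp ((log lam - lam) * j)) := by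
  rcases Nat.eq_zero_or_pos j with rfl | hj
  · simp [borelPMF, treeCoeff]
  have hj0 : (j : ℝ) ≠ 0 := by positivity
  have hexp : exp ((log lam - lam) * j) = lam ^ j * exp (-(lam * j)) := by
    rw [sub_mul, sub_eq_add_neg, exp_add, mul_comm (log lam), exp_nat_mul, exp_log hlam]
  obtain ⟨n, rfl⟩ : ∃ n, j = n + 1 := ⟨j - 1, by omega⟩
  rw [borelPMF, if_neg hj.ne', hexp, treeCoeff, Nat.add_sub_cancel, mul_pow, pow_succ lam,
    pow_succ (((n + 1 : ℕ)) : ℝ)]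
  field_simp

lemma tsum_exp_mul_borelPMF {lam : ℝ} (hlam : 0 < lam) (θ : ℝ) (k : ℕ) :
    ∑' j : ℕ, exp (θ * j) * ((j : ℝ) ^ k * borelPMF lam j) =
      lam⁻¹ * treeMoment k (θ + (log lam - lam)) := by
  rw [treeMoment, ← tsum_mul_left]
  refine tsum_congr fun j ↦ ?_
  rw [borelPMF_eq_treeCoeff hlam, add_mul, exp_add]
  ring

/-- The bound (4.1): with `γ = λ - log λ - 1 - δ > 0`,
`K = (λ/2)((1-λ)e^{-δ}/(λ√(2π)(1-e^{-δ})²) + 1/(1-λ)²)`, `Z ~ Borel(λ)` with size-biased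
version `Z⋆` (so `P(Z⋆ = j) = (1-λ) j q(j)`) and `m(θ) = E[e^{θZ}]`, one has
`E[e^{θZ⋆}] - E[e^{θZ}] ≤ Kθm(θ)` for every `θ ∈ (0, γ)`. -/
theorem borel_size_biased_mgf_bound (lam δ γ K : ℝ) (hlam0 : 0 < lam) (hlam1 : lam < 1)
    (hδ : 0 < δ) (hγ : γ = lam - Real.log lam - 1 - δ) (hγpos : 0 < γ)
    (hK : K = lam / 2 *
      ((1 - lam) * Real.exp (-δ) / (lam * Real.sqrt (2 * Real.pi) * (1 - Real.exp (-δ)) ^ 2)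
        + 1 / (1 - lam) ^ 2))
    (θ : ℝ) (hθ0 : 0 < θ) (hθγ : θ < γ) :
    (∑' j : ℕ, Real.exp (θ * j) * ((1 - lam) * (j : ℝ) * borelPMF lam j))
        - (∑' j : ℕ, Real.exp (θ * j) * borelPMF lam j)
      ≤ K * θ * ∑' j : ℕ, Real.exp (θ * j) * borelPMF lam j := by
  have hlog : log lam - lam < θ + (log lam - lam) := by linarith
  obtain ⟨w, haw, hw1, hws⟩ := exists_log_sub_eq hlam0 hlam1 hlog (by linarith)
  have hw : w ∈ Ioo (0 : ℝ) 1 := ⟨hlam0.trans haw, hw1⟩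
  have hZ : ∑' j : ℕ, exp (θ * j) * borelPMF lam j = lam⁻¹ * w := by
    simpa [← hws, treeMoment_zero_log_sub hw] using tsum_exp_mul_borelPMF hlam0 θ 0
  have hZstar : ∑' j : ℕ, exp (θ * j) * ((1 - lam) * (j : ℝ) * borelPMF lam j) =
      (1 - lam) * (lam⁻¹ * (w / (1 - w))) := by
    rw [← treeMoment_one_log_sub hw, hws, ← tsum_exp_mul_borelPMF hlam0 θ 1, ← tsum_mul_left]
    exact tsum_congr fun j ↦ by ring
  have hM : w / (1 - w) ^ 3 ≤ exp (-δ) / (√(2 * π) * (1 - exp (-δ)) ^ 2) := by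
    rw [← treeMoment_two_log_sub hw]
    exact treeMoment_two_le hδ (by linarith)
  have hKeq : K = ((1 - lam) * (exp (-δ) / (√(2 * π) * (1 - exp (-δ)) ^ 2)) +
      lam / (1 - lam) ^ 2) / 2 := by
    have h1 : 1 - exp (-δ) ≠ 0 := (sub_pos.2 (exp_lt_one_iff.2 (by linarith))).ne'
    have h2 : 1 - lam ≠ 0 := (sub_pos.2 hlam1).ne'
    rw [hK]
    field_simp
  have hbound : (w - lam) / (1 - w) ≤ K * θ := by
    refine (trapezoid_bound hlam0 haw.le hw1).trans ?_
    rw [hws, hKeq, add_sub_cancel_right]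
    calc θ / 2 * ((1 - lam) * (w / (1 - w) ^ 3) + lam / (1 - lam) ^ 2)
        ≤ θ / 2 * ((1 - lam) * (exp (-δ) / (√(2 * π) * (1 - exp (-δ)) ^ 2)) +
          lam / (1 - lam) ^ 2) := by
          have := sub_pos.2 hlam1
          gcongr
      _ = _ := by ring
  rw [hZ, hZstar]
  have h1 : 1 - w ≠ 0 := (sub_pos.2 hw1).ne'
  calc (1 - lam) * (lam⁻¹ * (w / (1 - w))) - lam⁻¹ * w
      = (w - lam) / (1 - w) * (lam⁻¹ * w) := by field_simp; ring
    _ ≤ K * θ * (lam⁻¹ * w) :=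
      mul_le_mul_of_nonneg_right hbound (mul_pos (inv_pos.2 hlam0) hw.1).le
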